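/- Fix a dimension d and an integer k ≥ 1. The following are equivalent: (i) for every pair of convex bodies K ⊆ L ⊆ ℝ^d one has E(V_K^k) ≤ E(V_L^k); (ii) for every convex body K ⊆ ℝ^d, every boundary point x of K, and X_1,...,X_d independent uniformly random points in K, one has E(V_K^k) ≤ E((vol conv{x, X_1, ..., X_d})^k). -/

import Mathlib

open MeasureTheory

/-- A convex body in `ℝ^d`: a compact convex set with nonempty interior. -/
def IsConvexBody {d : ℕ} (K : Set (EuclideanSpace ℝ (Fin d))) : Prop :=
  IsCompact K ∧ Convex ℝ K ∧ (interior K).Nonempty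

/-- `E(V_K^k)`: the `k`-th moment of the volume of the convex hull of `d+1`
independent uniformly random points in `K`. -/
noncomputable def momentVolSimplex (d k : ℕ) (K : Set (EuclideanSpace ℝ (Fin d))) : ℝ :=
  ⨍ X : Fin (d + 1) → EuclideanSpace ℝ (Fin d) in Set.univ.pi (fun _ => K),
    (volume (convexHull ℝ (Set.range X))).toReal ^ k

namespace SimplexMoment

open Set (range univ image_vadd range_comp)

/-- The volume of the simplex spanned by the points `P i`. -/
noncomputable def simplexVol {d : ℕ} (P : Fin (d + 1) → EuclideanSpace ℝ (Fin d)) : ℝ :=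
  (volume (convexHull ℝ (range P))).toReal

/-- The determinant of the edge vectors at the vertex `P 0`. -/
noncomputable def edgeDet {d : ℕ} (P : Fin (d + 1) → EuclideanSpace ℝ (Fin d)) : ℝ :=
  (EuclideanSpace.basisFun (Fin d) ℝ).toBasis.det fun i => P i.succ - P 0

variable {d : ℕ}

open scoped Pointwise in
theorem exists_simplexVol_eq_mul_abs_edgeDet (d : ℕ) :
    ∃ c : ℝ, 0 ≤ c ∧ ∀ P : Fin (d + 1) → EuclideanSpace ℝ (Fin d),
      simplexVol P = c * |edgeDet P| := by
  let e := (EuclideanSpace.basisFun (Fin d) ℝ).toBasis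
  let S : Fin (d + 1) → EuclideanSpace ℝ (Fin d) := Fin.cons 0 e
  refine ⟨simplexVol S, ENNReal.toReal_nonneg, fun P => ?_⟩
  let L : EuclideanSpace ℝ (Fin d) →ₗ[ℝ] EuclideanSpace ℝ (Fin d) :=
    e.constr ℝ fun i => P i.succ - P 0
  have hdet : LinearMap.det L = edgeDet P := by
    have h := e.det_comp L e
    rw [e.det_self, mul_one] at h
    rw [← h, edgeDet]
    congr 1
    ext1 i
    simp [L, e.constr_basis]
  have hP : range P = P 0 +ᵥ (L '' range S) := by
    rw [← image_vadd, ← range_comp, ← range_comp]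
    congr 1
    ext1 i
    refine Fin.cases ?_ (fun j => ?_) i
    · simp [S]
    · simp [S, L, e.constr_basis]
  unfold simplexVol
  rw [hP, convexHull_vadd, ← L.image_convexHull, measure_vadd,
    Measure.addHaar_image_linearMap, ENNReal.toReal_mul, hdet,
    ENNReal.toReal_ofReal (abs_nonneg _), mul_comm]

theorem continuous_edgeDet :
    Continuous (edgeDet : (Fin (d + 1) → EuclideanSpace ℝ (Fin d)) → ℝ) := by
  refine Continuous.matrix_det (continuous_matrix fun i j => ?_)
  simp only [Module.Basis.toMatrix_apply]
  simp
  fun_prop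

theorem continuous_simplexVol :
    Continuous (simplexVol : (Fin (d + 1) → EuclideanSpace ℝ (Fin d)) → ℝ) := by
  obtain ⟨c, -, h⟩ := exists_simplexVol_eq_mul_abs_edgeDet d
  rw [funext h]
  exact continuous_const.mul continuous_edgeDet.abs

theorem simplexVol_nonneg (P : Fin (d + 1) → EuclideanSpace ℝ (Fin d)) : 0 ≤ simplexVol P :=
  ENNReal.toReal_nonneg

theorem simplexVol_insertNth (i : Fin (d + 1)) (y : EuclideanSpace ℝ (Fin d))
    (X : Fin d → EuclideanSpace ℝ (Fin d)) :
    simplexVol (i.insertNth (α := fun _ => EuclideanSpace ℝ (Fin d)) y X) = simplexVol (Fin.cons y X) := by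
  have h : range (i.insertNth (α := fun _ => EuclideanSpace ℝ (Fin d)) y X) = insert y (range X) := by
    ext z
    rw [Set.mem_insert_iff, Set.mem_range, Fin.exists_iff_succAbove i]
    simp [eq_comm]
  rw [simplexVol, simplexVol, h, Fin.range_cons]

/-- With at least one other vertex, the volume of a simplex is convex in each vertex. -/
theorem convexOn_simplexVol_cons (X : Fin (d + 1) → EuclideanSpace ℝ (Fin (d + 1))) :
    ConvexOn ℝ univ fun y => simplexVol (Fin.cons y X) := by
  obtain ⟨c, hc, h⟩ := exists_simplexVol_eq_mul_abs_edgeDet (d + 1)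
  let D := (EuclideanSpace.basisFun (Fin (d + 1)) ℝ).toBasis.det
  let w : Fin (d + 1) → EuclideanSpace ℝ (Fin (d + 1)) := fun i => X i - X 0
  have key (y) : simplexVol (Fin.cons y X) =
      c * |D (Function.update w 0 (y - X 0))| := by
    rw [← simplexVol_insertNth 1 y X, h, edgeDet]
    congr 3
    ext1 i
    refine Fin.cases ?_ (fun j => ?_) i
    · have h0 : (Fin.succ 0 : Fin (d + 2)) = 1 := rfl
      have h1 : (0 : Fin (d + 2)) = Fin.succAbove 1 0 := by simp
      rw [h0, Fin.insertNth_apply_same, h1, Fin.insertNth_apply_succAbove]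
      simp
    · have h2 : j.succ.succ = Fin.succAbove (1 : Fin (d + 2)) j.succ := by
        rw [← Fin.succ_zero_eq_one, Fin.succ_succAbove_succ, Fin.zero_succAbove]
      have h1 : (0 : Fin (d + 2)) = Fin.succAbove 1 0 := by simp
      rw [h2, h1, Fin.insertNth_apply_succAbove, Fin.insertNth_apply_succAbove]
      simp [w]
  refine ⟨convex_univ, fun y _ z _ a b ha hb hab => ?_⟩
  have hlin : a • y + b • z - X 0 = a • (y - X 0) + b • (z - X 0) := by
    rw [smul_sub, smul_sub, sub_add_sub_comm, ← add_smul, hab, one_smul]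
  simp only [key, hlin, AlternatingMap.map_update_add, AlternatingMap.map_update_smul, smul_eq_mul]
  calc c * |a * D (Function.update w 0 (y - X 0)) + b * D (Function.update w 0 (z - X 0))|
      ≤ c * (|a * D (Function.update w 0 (y - X 0))| + |b * D (Function.update w 0 (z - X 0))|) := by
        gcongr
        exact abs_add_le _ _
    _ = _ := by rw [abs_mul, abs_mul, abs_of_nonneg ha, abs_of_nonneg hb]; ring


/-- The unnormalised `k`-th moment of the volume of a simplex with all vertices in `K`. -/
noncomputable def totalMoment (k : ℕ) (K : Set (EuclideanSpace ℝ (Fin d))) : ℝ :=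
  ∫ X in univ.pi (fun _ : Fin (d + 1) => K), simplexVol X ^ k

/-- The unnormalised `k`-th moment of the volume of a simplex with one vertex at `y` and the
others in `K`. -/
noncomputable def pointedMoment (k : ℕ) (K : Set (EuclideanSpace ℝ (Fin d)))
    (y : EuclideanSpace ℝ (Fin d)) : ℝ :=
  ∫ X in univ.pi (fun _ : Fin d => K), simplexVol (Fin.cons y X) ^ k

theorem momentVolSimplex_eq (k : ℕ) (K : Set (EuclideanSpace ℝ (Fin d))) :
    momentVolSimplex d k K = totalMoment k K / volume.real K ^ (d + 1) := by
  rw [momentVolSimplex, setAverage_eq, totalMoment, smul_eq_mul, div_eq_inv_mul, measureReal_def,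
    volume_pi_pi]
  simp [simplexVol, measureReal_def]

theorem setAverage_insert_eq (k : ℕ) (K : Set (EuclideanSpace ℝ (Fin d)))
    (x : EuclideanSpace ℝ (Fin d)) :
    ⨍ X : Fin d → EuclideanSpace ℝ (Fin d) in univ.pi (fun _ => K),
      (volume (convexHull ℝ (insert x (range X)))).toReal ^ k =
    pointedMoment k K x / volume.real K ^ d := by
  rw [setAverage_eq, pointedMoment, smul_eq_mul, div_eq_inv_mul, measureReal_def, volume_pi_pi]
  simp [simplexVol, measureReal_def, Fin.range_cons]

theorem continuous_simplexVol_cons (k : ℕ) :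
    Continuous fun p : EuclideanSpace ℝ (Fin d) × (Fin d → EuclideanSpace ℝ (Fin d)) =>
      simplexVol (Fin.cons p.1 p.2) ^ k :=
  (continuous_simplexVol.comp (continuous_fst.finCons continuous_snd)).pow k

theorem totalMoment_nonneg (k : ℕ) (K : Set (EuclideanSpace ℝ (Fin d))) : 0 ≤ totalMoment k K :=
  integral_nonneg fun X => pow_nonneg (simplexVol_nonneg X) k

theorem pointedMoment_nonneg (k : ℕ) (K : Set (EuclideanSpace ℝ (Fin d)))
    (y : EuclideanSpace ℝ (Fin d)) : 0 ≤ pointedMoment k K y :=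
  integral_nonneg fun _ => pow_nonneg (simplexVol_nonneg _) k

theorem continuous_pointedMoment (k : ℕ) {K : Set (EuclideanSpace ℝ (Fin d))} (hK : IsCompact K) :
    Continuous (pointedMoment k K) :=
  continuous_parametric_integral_of_continuous (continuous_simplexVol_cons k)
    (isCompact_univ_pi fun _ => hK)

theorem integrableOn_simplexVol_cons (k : ℕ) {K : Set (EuclideanSpace ℝ (Fin d))}
    (hK : IsCompact K) (y : EuclideanSpace ℝ (Fin d)) :
    IntegrableOn (fun X : Fin d → EuclideanSpace ℝ (Fin d) => simplexVol (Fin.cons y X) ^ k)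
      (univ.pi fun _ => K) :=
  ((continuous_simplexVol_cons k).comp (Continuous.prodMk_right y)).continuousOn.integrableOn_compact
    (isCompact_univ_pi fun _ => hK)

theorem pointedMoment_mono (k : ℕ) {K L : Set (EuclideanSpace ℝ (Fin d))} (hL : IsCompact L)
    (h : K ⊆ L) (y : EuclideanSpace ℝ (Fin d)) : pointedMoment k K y ≤ pointedMoment k L y :=
  setIntegral_mono_set (integrableOn_simplexVol_cons k hL y)
    (ae_of_all _ fun _ => pow_nonneg (simplexVol_nonneg _) k)
    (Set.pi_mono fun _ _ => h).eventuallyLE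

theorem totalMoment_mono (k : ℕ) {K L : Set (EuclideanSpace ℝ (Fin d))} (hL : IsCompact L)
    (h : K ⊆ L) : totalMoment k K ≤ totalMoment k L :=
  setIntegral_mono_set
    ((continuous_simplexVol.pow k).continuousOn.integrableOn_compact
      (isCompact_univ_pi fun _ => hL))
    (ae_of_all _ fun _ => pow_nonneg (simplexVol_nonneg _) k)
    (Set.pi_mono fun _ _ => h).eventuallyLE

theorem setIntegral_pi_insertNth (k : ℕ) {A B C : Set (EuclideanSpace ℝ (Fin d))}
    (hC : IsCompact C) (hA : A ⊆ C) (hB : B ⊆ C) (i : Fin (d + 1)) :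
    ∫ X in univ.pi (i.insertNth (α := fun _ => Set (EuclideanSpace ℝ (Fin d))) A fun _ => B),
      simplexVol X ^ k = ∫ y in A, pointedMoment k B y := by
  let e := MeasurableEquiv.piFinSuccAbove (fun _ => EuclideanSpace ℝ (Fin d)) i
  have he : MeasurePreserving e := volume_preserving_piFinSuccAbove _ i
  have hset : univ.pi (i.insertNth (α := fun _ => Set (EuclideanSpace ℝ (Fin d))) A fun _ => B) =
      e ⁻¹' (A ×ˢ univ.pi fun _ => B) := by
    ext X
    simp [e, Fin.forall_iff_succAbove i, MeasurableEquiv.piFinSuccAbove, Fin.insertNthEquiv,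
      Fin.removeNth]
  have hf (X : Fin (d + 1) → EuclideanSpace ℝ (Fin d)) :
      simplexVol X ^ k = simplexVol (Fin.cons (e X).1 (e X).2) ^ k := by
    rw [← simplexVol_insertNth i]
    congr 2
    exact (e.symm_apply_apply X).symm
  rw [hset, funext hf, he.setIntegral_preimage_emb e.measurableEmbedding
    (fun p => simplexVol (Fin.cons p.1 p.2) ^ k), Measure.volume_eq_prod, setIntegral_prod]
  · rfl
  · exact ((continuous_simplexVol_cons k).continuousOn.integrableOn_compact
      (hC.prod (isCompact_univ_pi fun _ => hC))).mono_set
      (Set.prod_mono hA (Set.pi_mono fun _ _ => hB))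

/-- The measure with density `simplexVol ^ k` on tuples of points. -/
noncomputable def momentMeasure (d k : ℕ) : Measure (Fin (d + 1) → EuclideanSpace ℝ (Fin d)) :=
  volume.withDensity fun X => ENNReal.ofReal (simplexVol X ^ k)

theorem momentMeasure_real (k : ℕ) (S : Set (Fin (d + 1) → EuclideanSpace ℝ (Fin d))) :
    (momentMeasure d k).real S = ∫ X in S, simplexVol X ^ k := by
  rw [integral_eq_lintegral_of_nonneg_ae (ae_of_all _ fun _ => pow_nonneg (simplexVol_nonneg _) k)
    (continuous_simplexVol.pow k).aestronglyMeasurable, measureReal_def, momentMeasure,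
    withDensity_apply']

theorem momentMeasure_ne_top (k : ℕ) {L : Set (EuclideanSpace ℝ (Fin d))} (hL : IsCompact L)
    {S : Set (Fin (d + 1) → EuclideanSpace ℝ (Fin d))} (hS : S ⊆ univ.pi fun _ => L) :
    momentMeasure d k S ≠ ⊤ := by
  refine ne_top_of_le_ne_top ?_ (measure_mono hS)
  rw [momentMeasure, withDensity_apply']
  exact ((hasFiniteIntegral_iff_ofReal
    (ae_of_all _ fun _ => pow_nonneg (simplexVol_nonneg _) k)).1
    ((continuous_simplexVol.pow k).continuousOn.integrableOn_compact
      (isCompact_univ_pi fun _ => hL)).2).ne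

/-- Enlarging `K` to `L` increases the moment at most by the contribution of simplices with a
vertex in `L \ K` and the others in `L`. -/
theorem totalMoment_le_add (k : ℕ) {K L : Set (EuclideanSpace ℝ (Fin d))}
    (hL : IsCompact L) (hKL : K ⊆ L) :
    totalMoment k L ≤ totalMoment k K + (d + 1) * ∫ y in L \ K, pointedMoment k L y := by
  let T (i : Fin (d + 1)) : Set (Fin (d + 1) → EuclideanSpace ℝ (Fin d)) :=
    univ.pi (i.insertNth (α := fun _ => Set (EuclideanSpace ℝ (Fin d))) (L \ K) fun _ => L)
  have hT (i) : (momentMeasure d k).real (T i) = ∫ y in L \ K, pointedMoment k L y := by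
    rw [momentMeasure_real, setIntegral_pi_insertNth k hL Set.sdiff_subset subset_rfl]
  have hmem (i X) : X ∈ T i ↔ (X i ∈ L ∧ X i ∉ K) ∧ ∀ j, X (i.succAbove j) ∈ L := by
    simp [T, Fin.forall_iff_succAbove i]
  have hTL (i) : T i ⊆ univ.pi fun _ => L := by
    intro X hX
    rw [hmem] at hX
    rw [Set.mem_univ_pi, Fin.forall_iff_succAbove i]
    exact ⟨hX.1.1, hX.2⟩
  have hsub : (univ.pi fun _ => L) ⊆ (univ.pi fun _ => K) ∪ ⋃ i, T i := by
    intro X hX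
    by_cases h : ∀ i, X i ∈ K
    · exact Or.inl fun i _ => h i
    · push Not at h
      obtain ⟨i, hi⟩ := h
      exact Or.inr (Set.mem_iUnion.2
        ⟨i, (hmem i X).2 ⟨⟨hX i trivial, hi⟩, fun j => hX _ trivial⟩⟩)
  have hKL' : (univ.pi fun _ : Fin (d + 1) => K) ⊆ univ.pi fun _ => L := Set.pi_mono fun _ _ => hKL
  calc totalMoment k L = (momentMeasure d k).real (univ.pi fun _ => L) :=
        (momentMeasure_real k _).symm
    _ ≤ (momentMeasure d k).real ((univ.pi fun _ => K) ∪ ⋃ i, T i) :=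
        measureReal_mono hsub (momentMeasure_ne_top k hL
          (Set.union_subset hKL' (Set.iUnion_subset hTL)))
    _ ≤ (momentMeasure d k).real (univ.pi fun _ => K) + ∑ i, (momentMeasure d k).real (T i) :=
        (measureReal_union_le _ _).trans
          (add_le_add_right (measureReal_iUnion_fintype_le _) _)
    _ = _ := by simp [hT, momentMeasure_real, totalMoment]

/-- Enlarging `K` to `L` increases the moment at least by the contribution of simplices with one
vertex in `L \ K` and the others in `K`. -/
theorem add_le_totalMoment (k : ℕ) {K L : Set (EuclideanSpace ℝ (Fin d))}
    (hKm : MeasurableSet K) (hL : IsCompact L) (hKL : K ⊆ L) :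
    totalMoment k K + (d + 1) * ∫ y in L \ K, pointedMoment k K y ≤ totalMoment k L := by
  let T (i : Fin (d + 1)) : Set (Fin (d + 1) → EuclideanSpace ℝ (Fin d)) :=
    univ.pi (i.insertNth (α := fun _ => Set (EuclideanSpace ℝ (Fin d))) (L \ K) fun _ => K)
  have hT (i) : (momentMeasure d k).real (T i) = ∫ y in L \ K, pointedMoment k K y := by
    rw [momentMeasure_real, setIntegral_pi_insertNth k hL Set.sdiff_subset hKL]
  have hmem (i X) : X ∈ T i ↔ (X i ∈ L ∧ X i ∉ K) ∧ ∀ j, X (i.succAbove j) ∈ K := by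
    simp [T, Fin.forall_iff_succAbove i]
  have hTL (i) : T i ⊆ univ.pi fun _ => L := by
    intro X hX
    rw [hmem] at hX
    rw [Set.mem_univ_pi, Fin.forall_iff_succAbove i]
    exact ⟨hX.1.1, fun j => hKL (hX.2 j)⟩
  have hTm (i) : MeasurableSet (T i) := by
    refine MeasurableSet.univ_pi fun j => ?_
    refine i.succAboveCases ?_ (fun j => ?_) j
    · simpa using hL.measurableSet.diff hKm
    · simpa using hKm
  have hdisj : Pairwise (Function.onFun Disjoint T) := by
    intro i j hij
    refine Set.disjoint_left.2 fun X hi hj => ?_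
    rw [hmem] at hi hj
    obtain ⟨l, rfl⟩ := Fin.exists_succAbove_eq hij
    exact hi.1.2 (hj.2 l)
  have hdisj' : Disjoint (univ.pi fun _ => K) (⋃ i, T i) := by
    refine Set.disjoint_left.2 fun X hX h => ?_
    obtain ⟨i, hi⟩ := Set.mem_iUnion.1 h
    exact ((hmem i X).1 hi).1.2 (hX i trivial)
  have hKL' : (univ.pi fun _ : Fin (d + 1) => K) ⊆ univ.pi fun _ => L := Set.pi_mono fun _ _ => hKL
  calc totalMoment k K + (d + 1) * ∫ y in L \ K, pointedMoment k K y
      = (momentMeasure d k).real ((univ.pi fun _ => K) ∪ ⋃ i, T i) := by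
        rw [measureReal_union hdisj' (.iUnion hTm) (momentMeasure_ne_top k hL hKL')
          (momentMeasure_ne_top k hL (Set.iUnion_subset hTL)),
          measureReal_iUnion_fintype hdisj hTm (fun i => momentMeasure_ne_top k hL (hTL i))]
        simp [hT, momentMeasure_real, totalMoment]
    _ ≤ (momentMeasure d k).real (univ.pi fun _ => L) :=
        measureReal_mono (Set.union_subset hKL' (Set.iUnion_subset hTL))
          (momentMeasure_ne_top k hL subset_rfl)
    _ = totalMoment k L := momentMeasure_real k _

theorem totalMoment_eq_integral (k : ℕ) {K : Set (EuclideanSpace ℝ (Fin d))} (hK : IsCompact K) :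
    totalMoment k K = ∫ y in K, pointedMoment k K y := by
  rw [← setIntegral_pi_insertNth k hK subset_rfl subset_rfl 0, totalMoment]
  congr 3
  ext i
  refine Fin.cases ?_ (fun j => ?_) i <;> simp

theorem _root_.IsConvexBody.measureReal_pos {K : Set (EuclideanSpace ℝ (Fin d))}
    (hK : IsConvexBody K) : 0 < volume.real K :=
  ENNReal.toReal_pos (Measure.measure_pos_of_nonempty_interior _ hK.2.2).ne' hK.1.measure_ne_top

theorem _root_.IsConvexBody.subset_closure_interior {K : Set (EuclideanSpace ℝ (Fin d))}
    (hK : IsConvexBody K) : K ⊆ closure (interior K) := by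
  rw [hK.2.1.closure_interior_eq_closure_of_nonempty_interior hK.2.2]
  exact subset_closure

theorem measureReal_lt_of_notMem {A K : Set (EuclideanSpace ℝ (Fin d))} (hA : IsConvexBody A)
    (hK : IsConvexBody K) (hAK : A ⊆ K) {x : EuclideanSpace ℝ (Fin d)} (hxK : x ∈ K)
    (hxA : x ∉ A) : volume.real A < volume.real K := by
  have hne : (Aᶜ ∩ interior K).Nonempty :=
    mem_closure_iff.1 (hK.subset_closure_interior hxK) _ hA.1.isClosed.isOpen_compl hxA
  have hopen : IsOpen (Aᶜ ∩ interior K) := hA.1.isClosed.isOpen_compl.inter isOpen_interior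
  have hpos : 0 < volume.real (K \ A) := by
    refine ENNReal.toReal_pos ?_ (measure_ne_top_of_subset Set.sdiff_subset hK.1.measure_ne_top)
    exact ((hopen.measure_pos volume hne).trans_le
      (measure_mono fun y hy => (⟨interior_subset hy.2, hy.1⟩ : y ∈ K \ A))).ne'
  rw [measureReal_sdiff hAK hA.1.measurableSet hK.1.measure_ne_top] at hpos
  linarith

theorem pow_add_mul_le_pow {a b : ℝ} (hb : 0 ≤ b) (hab : b ≤ a) (n : ℕ) :
    b ^ (n + 1) + (n + 1) * b ^ n * (a - b) ≤ a ^ (n + 1) := by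
  induction n with
  | zero => simp
  | succ n ih =>
    have h1 := mul_le_mul_of_nonneg_left ih (hb.trans hab)
    have h2 : 0 ≤ (n + 1) * b ^ n * (a - b) ^ 2 := by positivity
    push_cast
    calc _ ≤ b ^ (n + 1 + 1) + ((n : ℝ) + 1 + 1) * b ^ (n + 1) * (a - b) +
          (n + 1) * b ^ n * (a - b) ^ 2 := by linarith
      _ = a * (b ^ (n + 1) + (n + 1) * b ^ n * (a - b)) := by ring
      _ ≤ _ := h1.trans_eq (by ring)

/-- Cutting a small neighbourhood of `x` off a convex body does not increase the moment, so `x`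
is a good vertex. -/
theorem totalMoment_le_of_cut (k : ℕ)
    (hmono : ∀ K L : Set (EuclideanSpace ℝ (Fin d)), IsConvexBody K → IsConvexBody L → K ⊆ L →
      momentVolSimplex d k K ≤ momentVolSimplex d k L)
    {K : Set (EuclideanSpace ℝ (Fin d))} (hK : IsConvexBody K) {x : EuclideanSpace ℝ (Fin d)}
    (hxK : x ∈ K) (hx : volume {x} = 0)
    (hcut : ∀ U ∈ nhds x, ∃ A, IsConvexBody A ∧ A ⊆ K ∧ x ∉ A ∧ K \ A ⊆ U) :
    totalMoment k K ≤ volume.real K * pointedMoment k K x := by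
  have hV := hK.measureReal_pos
  set V := volume.real K with hVdef
  set F := totalMoment k K with hF
  set g := pointedMoment k K x with hg
  have key (η : ℝ) (hη : η ∈ Set.Ioo (0 : ℝ) 1) : F * (1 - η) ^ d ≤ V * (g + η) := by
    obtain ⟨U, hxU, hU, hUη⟩ := Set.exists_isOpen_lt_of_lt {x} (ENNReal.ofReal (η * V))
      (by rw [hx, ENNReal.ofReal_pos]; exact mul_pos hη.1 hV)
    have hgU : {y | pointedMoment k K y < g + η} ∈ nhds x :=
      (continuous_pointedMoment k hK.1).continuousAt.eventually_lt continuousAt_const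
        (by simp [hg, hη.1])
    obtain ⟨A, hA, hAK, hxA, hKA⟩ := hcut _
      (Filter.inter_mem (hU.mem_nhds (Set.singleton_subset_iff.1 hxU)) hgU)
    have hlt := measureReal_lt_of_notMem hA hK hAK hxK hxA
    have hsd : volume.real (K \ A) = V - volume.real A :=
      measureReal_sdiff hAK hA.1.measurableSet hK.1.measure_ne_top
    have hVA := hA.measureReal_pos
    set W := volume.real A with hW
    have hsmall : V - W ≤ η * V := by
      rw [← hsd]
      refine ENNReal.toReal_le_of_le_ofReal (mul_pos hη.1 hV).le ?_
      exact (measure_mono (hKA.trans Set.inter_subset_left)).trans hUη.le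
    have hint : ∫ y in K \ A, pointedMoment k K y ≤ (V - W) * (g + η) := by
      rw [← hsd, ← smul_eq_mul, ← setIntegral_const]
      refine setIntegral_mono_on ?_ ?_ (hK.1.measurableSet.diff hA.1.measurableSet)
        fun y hy => (hKA hy).2.le
      · exact ((continuous_pointedMoment k hK.1).continuousOn.integrableOn_compact hK.1).mono_set
          Set.sdiff_subset
      · exact integrableOn_const
          (measure_ne_top_of_subset Set.sdiff_subset hK.1.measure_ne_top)
    have hup := totalMoment_le_add k hK.1 hAK
    have hm := hmono A K hA hK hAK
    rw [momentVolSimplex_eq, momentVolSimplex_eq, div_le_div_iff₀ (by positivity) (by positivity)]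
      at hm
    have hbern := pow_add_mul_le_pow hVA.le hlt.le d
    have hF0 : 0 ≤ F := totalMoment_nonneg k K
    have hgη : 0 ≤ g + η := add_nonneg (pointedMoment_nonneg k K x) hη.1.le
    have h1 : F ≤ totalMoment k A + (d + 1) * ((V - W) * (g + η)) :=
      hup.trans (by gcongr)
    have h2 : F * V ^ (d + 1) ≤ F * W ^ (d + 1) + (d + 1) * ((V - W) * (g + η)) * V ^ (d + 1) := by
      calc F * V ^ (d + 1)
          ≤ (totalMoment k A + (d + 1) * ((V - W) * (g + η))) * V ^ (d + 1) := by gcongr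
        _ ≤ _ := by rw [add_mul]; gcongr
    have h3 : (((d : ℝ) + 1) * (V - W)) * (F * W ^ d) ≤
        (((d : ℝ) + 1) * (V - W)) * ((g + η) * V ^ (d + 1)) := by
      have := mul_le_mul_of_nonneg_left hbern hF0
      linarith
    have h4 : F * W ^ d ≤ (g + η) * V ^ (d + 1) :=
      le_of_mul_le_mul_left h3 (mul_pos (by positivity) (sub_pos.2 hlt))
    have h5 : V ^ d * (F * (1 - η) ^ d) ≤ V ^ d * (V * (g + η)) := by
      have h6 : ((1 - η) * V) ^ d ≤ W ^ d :=
        pow_le_pow_left₀ (mul_nonneg (by linarith [hη.2]) hV.le) (by linarith) d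
      calc V ^ d * (F * (1 - η) ^ d) = F * ((1 - η) * V) ^ d := by rw [mul_pow]; ring
        _ ≤ F * W ^ d := by gcongr
        _ ≤ _ := h4.trans_eq (by ring)
    exact le_of_mul_le_mul_left h5 (by positivity)
  have hl : Filter.Tendsto (fun η : ℝ => F * (1 - η) ^ d) (nhdsWithin 0 (Set.Ioi 0)) (nhds F) :=
    tendsto_nhdsWithin_of_tendsto_nhds
      (Continuous.tendsto' (by fun_prop) _ _ (by simp))
  have hr : Filter.Tendsto (fun η : ℝ => V * (g + η)) (nhdsWithin 0 (Set.Ioi 0))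
      (nhds (V * g)) :=
    tendsto_nhdsWithin_of_tendsto_nhds
      (Continuous.tendsto' (by fun_prop) _ _ (by simp))
  exact le_of_tendsto_of_tendsto hl hr
    (Filter.mem_of_superset (Ioo_mem_nhdsGT one_pos) key)

theorem convexHull_insert_eq_image {A : Set (EuclideanSpace ℝ (Fin d))} (hA : Convex ℝ A)
    (hne : A.Nonempty) (x : EuclideanSpace ℝ (Fin d)) :
    convexHull ℝ (insert x A) =
      (fun p : ℝ × EuclideanSpace ℝ (Fin d) => p.1 • (p.2 - x) + x) '' (Set.Icc 0 1 ×ˢ A) := by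
  rw [convexHull_insert hne, hA.convexHull_eq, convexJoin_singleton_left]
  ext z
  simp only [Set.mem_iUnion, segment_eq_image_lineMap, Set.mem_image, Prod.exists, Set.mem_prod,
    AffineMap.lineMap_apply, vsub_eq_sub, vadd_eq_add]
  grind

theorem isConvexBody_convexHull_insert {A : Set (EuclideanSpace ℝ (Fin d))}
    (hA : IsConvexBody A) (x : EuclideanSpace ℝ (Fin d)) :
    IsConvexBody (convexHull ℝ (insert x A)) := by
  refine ⟨?_, convex_convexHull ℝ _, hA.2.2.mono (interior_mono
    ((Set.subset_insert _ _).trans (subset_convexHull ℝ _)))⟩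
  rw [convexHull_insert_eq_image hA.2.1 (hA.2.2.mono interior_subset)]
  exact (isCompact_Icc.prod hA.1).image (by fun_prop)

/-- An apex of a convex body can be cut off by arbitrarily small caps. -/
theorem exists_cut_convexHull_insert {A : Set (EuclideanSpace ℝ (Fin d))}
    (hA : IsConvexBody A) {x : EuclideanSpace ℝ (Fin d)} (hx : x ∉ A)
    {U : Set (EuclideanSpace ℝ (Fin d))} (hU : U ∈ nhds x) :
    ∃ B, IsConvexBody B ∧ B ⊆ convexHull ℝ (insert x A) ∧ x ∉ B ∧
      convexHull ℝ (insert x A) \ B ⊆ U := by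
  obtain ⟨f, s, hfA, hfx⟩ := geometric_hahn_banach_closed_point hA.2.1 hA.1.isClosed hx
  obtain ⟨ε, hε, hεU⟩ := Metric.mem_nhds_iff.1 hU
  obtain ⟨R, hR0, hR⟩ := (hA.1.image (f := fun a => a - x) (by fun_prop)).isBounded.exists_pos_norm_le
  have hK := isConvexBody_convexHull_insert hA x
  set t : ℝ := min 1 (ε / (2 * R)) with ht
  have ht0 : 0 < t := lt_min one_pos (by positivity)
  have htR : t * R < ε := by
    calc t * R ≤ ε / (2 * R) * R := by gcongr; exact min_le_right _ _
      _ = ε / 2 := by field_simp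
      _ < ε := half_lt_self hε
  set δ : ℝ := t * (f x - s) with hδ
  have hδ0 : 0 < δ := mul_pos ht0 (sub_pos.2 hfx)
  have hδs : s ≤ f x - δ := by
    have : δ ≤ 1 * (f x - s) := mul_le_mul_of_nonneg_right (min_le_left _ _) (sub_pos.2 hfx).le
    linarith
  refine ⟨convexHull ℝ (insert x A) ∩ {y | f y ≤ f x - δ}, ⟨?_, ?_, ?_⟩, Set.inter_subset_left,
    ?_, ?_⟩
  · exact hK.1.inter_right (isClosed_le f.continuous continuous_const)
  · exact hK.2.1.inter (convex_halfSpace_le f.toLinearMap.isLinear _)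
  · exact hA.2.2.mono (interior_mono fun a ha => ⟨subset_convexHull ℝ _ (Set.mem_insert_of_mem _ ha),
      (hfA a ha).le.trans hδs⟩)
  · rintro ⟨-, h : f x ≤ f x - δ⟩
    linarith
  · rintro y ⟨hy, hyB⟩
    have hfy : f x - δ < f y := by
      by_contra! h
      exact hyB ⟨hy, h⟩
    rw [convexHull_insert_eq_image hA.2.1 (hA.2.2.mono interior_subset)] at hy
    obtain ⟨⟨τ, a⟩, ⟨hτ, ha⟩, rfl⟩ := hy
    simp only [map_add, map_smul, map_sub, smul_eq_mul] at hfy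
    have hfa := hfA a ha
    have hτt : τ < t := by
      by_contra! h
      have h1 : t * (f x - s) ≤ τ * (f x - f a) :=
        mul_le_mul h (by linarith) (sub_pos.2 hfx).le hτ.1
      linarith
    apply hεU
    rw [Metric.mem_ball, dist_eq_norm, add_sub_cancel_right, norm_smul, Real.norm_of_nonneg hτ.1]
    calc τ * ‖a - x‖ ≤ t * R :=
          mul_le_mul hτt.le (hR _ ⟨a, ha, rfl⟩) (norm_nonneg _) ht0.le
      _ < ε := htR

theorem isConvexBody_homothety {K : Set (EuclideanSpace ℝ (Fin d))} (hK : IsConvexBody K)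
    (c : EuclideanSpace ℝ (Fin d)) {r : ℝ} (hr : r ≠ 0) :
    IsConvexBody (AffineMap.homothety c r '' K) :=
  ⟨hK.1.image (AffineMap.homothety_continuous c r), hK.2.1.affine_image _,
    (hK.2.2.image _).mono ((AffineMap.homothety_isOpenMap c r hr).image_interior_subset K)⟩

theorem measureReal_homothety (K : Set (EuclideanSpace ℝ (Fin d)))
    (c : EuclideanSpace ℝ (Fin d)) {r : ℝ} (hr : 0 ≤ r) :
    volume.real (AffineMap.homothety c r '' K) = r ^ d * volume.real K := by
  rw [measureReal_def, Measure.addHaar_image_homothety, finrank_euclideanSpace_fin,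
    abs_of_nonneg (pow_nonneg hr d), ENNReal.toReal_mul, ENNReal.toReal_ofReal (pow_nonneg hr d),
    measureReal_def]

theorem homothety_image_subset {K : Set (EuclideanSpace ℝ (Fin d))} (hK : Convex ℝ K)
    {c : EuclideanSpace ℝ (Fin d)} (hc : c ∈ K) {r : ℝ} (hr : r ∈ Set.Icc (0 : ℝ) 1) :
    AffineMap.homothety c r '' K ⊆ K := by
  rintro _ ⟨y, hy, rfl⟩
  rw [AffineMap.homothety_eq_lineMap]
  exact hK.lineMap_mem hc hy hr

theorem homothety_image_subset_interior {K : Set (EuclideanSpace ℝ (Fin d))} (hK : Convex ℝ K)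
    {c : EuclideanSpace ℝ (Fin d)} (hc : c ∈ interior K) {r : ℝ} (hr : r ∈ Set.Ioo (0 : ℝ) 1) :
    AffineMap.homothety c r '' K ⊆ interior K := by
  rintro _ ⟨y, hy, rfl⟩
  refine hK.openSegment_interior_self_subset_interior hc hy ?_
  rw [openSegment_eq_image_lineMap, AffineMap.homothety_eq_lineMap]
  exact ⟨r, hr, rfl⟩

/-- If the moment is monotone, then a boundary point is at least as good a vertex as a random
point. -/
theorem totalMoment_le_of_mono (k : ℕ)
    (hmono : ∀ K L : Set (EuclideanSpace ℝ (Fin d)), IsConvexBody K → IsConvexBody L → K ⊆ L →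
      momentVolSimplex d k K ≤ momentVolSimplex d k L)
    {K : Set (EuclideanSpace ℝ (Fin d))} (hK : IsConvexBody K) {x : EuclideanSpace ℝ (Fin d)}
    (hxK : x ∈ frontier K) (hx : volume {x} = 0) :
    totalMoment k K ≤ volume.real K * pointedMoment k K x := by
  obtain ⟨c, hc⟩ := hK.2.2
  have hxK' : x ∈ K := hK.1.isClosed.frontier_subset hxK
  obtain ⟨M, hM⟩ := hK.1.bddAbove_image (continuous_pointedMoment k hK.1).continuousOn
  have key (r : ℝ) (hr : r ∈ Set.Ioo (0 : ℝ) 1) :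
      totalMoment k K ≤ volume.real K * pointedMoment k K x +
        (d + 1) * ((volume.real K - r ^ d * volume.real K) * M) := by
    set A := AffineMap.homothety c r '' K with hAdef
    have hA : IsConvexBody A := isConvexBody_homothety hK c hr.1.ne'
    have hAK : A ⊆ K := homothety_image_subset hK.2.1 (interior_subset hc) ⟨hr.1.le, hr.2.le⟩
    have hxA : x ∉ A := fun h => hxK.2 (homothety_image_subset_interior hK.2.1 hc hr h)
    set B := convexHull ℝ (insert x A) with hB
    have hBK : B ⊆ K := convexHull_min (Set.insert_subset hxK' hAK) hK.2.1
    have hB' : IsConvexBody B := isConvexBody_convexHull_insert hA x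
    have h1 : totalMoment k A ≤ totalMoment k B :=
      totalMoment_mono k hB'.1 ((Set.subset_insert _ _).trans (subset_convexHull ℝ _))
    have h2 : totalMoment k B ≤ volume.real B * pointedMoment k B x :=
      totalMoment_le_of_cut k hmono hB' (subset_convexHull ℝ _ (Set.mem_insert _ _)) hx
        fun U hU => exists_cut_convexHull_insert hA hxA hU
    have h3 : volume.real B * pointedMoment k B x ≤ volume.real K * pointedMoment k K x :=
      mul_le_mul (measureReal_mono hBK hK.1.measure_ne_top) (pointedMoment_mono k hK.1 hBK x)
        (pointedMoment_nonneg k B x) measureReal_nonneg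
    have h4 : ∫ y in K \ A, pointedMoment k K y ≤
        (volume.real K - r ^ d * volume.real K) * M := by
      rw [← measureReal_homothety K c hr.1.le,
        ← measureReal_sdiff hAK hA.1.measurableSet hK.1.measure_ne_top, ← smul_eq_mul,
        ← setIntegral_const]
      refine setIntegral_mono_on ?_ ?_ (hK.1.measurableSet.diff hA.1.measurableSet)
        fun y hy => hM ⟨y, hy.1, rfl⟩
      · exact ((continuous_pointedMoment k hK.1).continuousOn.integrableOn_compact hK.1).mono_set
          Set.sdiff_subset
      · exact integrableOn_const
          (measure_ne_top_of_subset Set.sdiff_subset hK.1.measure_ne_top)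
    calc totalMoment k K ≤ totalMoment k A + (d + 1) * ∫ y in K \ A, pointedMoment k K y :=
          totalMoment_le_add k hK.1 hAK
      _ ≤ _ := add_le_add (h1.trans (h2.trans h3)) (by gcongr)
  have hlim : Filter.Tendsto (fun r : ℝ => volume.real K * pointedMoment k K x +
        (d + 1) * ((volume.real K - r ^ d * volume.real K) * M)) (nhdsWithin 1 (Set.Iio 1))
      (nhds (volume.real K * pointedMoment k K x)) :=
    tendsto_nhdsWithin_of_tendsto_nhds (Continuous.tendsto' (by fun_prop) _ _ (by simp))
  exact ge_of_tendsto hlim (Filter.mem_of_superset (Ioo_mem_nhdsLT one_pos) key)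

theorem convexOn_pointedMoment (k : ℕ) {K : Set (EuclideanSpace ℝ (Fin (d + 1)))}
    (hK : IsCompact K) : ConvexOn ℝ univ (pointedMoment k K) := by
  refine ⟨convex_univ, fun y _ z _ a b ha hb hab => ?_⟩
  have hint := integrableOn_simplexVol_cons k hK
  simp only [pointedMoment, smul_eq_mul]
  rw [← integral_const_mul, ← integral_const_mul,
    ← integral_add ((hint y).const_mul a) ((hint z).const_mul b)]
  exact integral_mono (hint _) (((hint y).const_mul a).add ((hint z).const_mul b)) fun X =>
    ((convexOn_simplexVol_cons X).pow (fun _ _ => simplexVol_nonneg _) k).2 trivial trivial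
      ha hb hab

/-- If every boundary point is at least as good a vertex as a random point, then so is every
exterior point. -/
theorem totalMoment_le_of_notMem (k : ℕ) {K : Set (EuclideanSpace ℝ (Fin (d + 1)))}
    (hK : IsConvexBody K)
    (hbd : ∀ x ∈ frontier K, totalMoment k K ≤ volume.real K * pointedMoment k K x)
    {y : EuclideanSpace ℝ (Fin (d + 1))} (hy : y ∉ K) :
    totalMoment k K ≤ volume.real K * pointedMoment k K y := by
  by_contra! hlt
  have hV := hK.measureReal_pos
  set m := totalMoment k K / volume.real K with hm
  have hym : pointedMoment k K y < m := by rwa [hm, lt_div_iff₀ hV, mul_comm]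
  have hconv := convexOn_pointedMoment k hK.1
  have : Fact (volume K < ⊤) := ⟨hK.1.measure_lt_top⟩
  obtain ⟨z, hz, hzm⟩ : ∃ z ∈ interior K, pointedMoment k K z ≤ m := by
    obtain ⟨z, hz, hzm⟩ := exists_notMem_null_le_average (μ := volume.restrict K)
      (N := (interior K)ᶜ) (f := pointedMoment k K)
      (by
        rw [Ne, Measure.restrict_eq_zero]
        exact (Measure.measure_pos_of_nonempty_interior _ hK.2.2).ne')
      ((continuous_pointedMoment k hK.1).continuousOn.integrableOn_compact hK.1)
      (by
        rw [Measure.restrict_apply isOpen_interior.measurableSet.compl, Set.inter_comm,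
          ← Set.sdiff_eq]
        exact measure_mono_null (Set.sdiff_subset_sdiff_left subset_closure)
          (hK.2.1.addHaar_frontier volume))
    refine ⟨z, by simpa using hz, hzm.trans_eq ?_⟩
    rw [setAverage_eq, ← totalMoment_eq_integral k hK.1, smul_eq_mul, hm, div_eq_inv_mul]
  obtain ⟨w, hw, hwm⟩ : ∃ w ∈ interior K, pointedMoment k K w < m := by
    have hnear : ∀ᶠ t : ℝ in nhdsWithin 0 (Set.Ioi 0), AffineMap.lineMap z y t ∈ interior K :=
      tendsto_nhdsWithin_of_tendsto_nhds
        (AffineMap.lineMap_continuous.tendsto' 0 z (AffineMap.lineMap_apply_zero z y))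
        (isOpen_interior.mem_nhds hz)
    obtain ⟨t, ht, ht01⟩ := (hnear.and (Ioo_mem_nhdsGT one_pos)).exists
    refine ⟨_, ht, ?_⟩
    rw [AffineMap.lineMap_apply_module]
    refine (hconv.2 trivial trivial (sub_nonneg.2 ht01.2.le) ht01.1.le (by ring)).trans_lt ?_
    have h1 := mul_le_mul_of_nonneg_left hzm (sub_nonneg.2 ht01.2.le)
    have h2 := mul_lt_mul_of_pos_left hym ht01.1
    simp only [smul_eq_mul]
    linarith
  have hsub : IsPreconnected {v | v ∈ univ ∧ pointedMoment k K v < m} :=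
    (hconv.convex_lt m).isPreconnected
  obtain ⟨v, -, hvK, hvK'⟩ := hsub (interior K) Kᶜ isOpen_interior hK.1.isClosed.isOpen_compl
    (fun v hv => by
      by_contra hvK
      rw [Set.mem_union, Set.mem_compl_iff, not_or, not_not] at hvK
      have hvm := hbd v ⟨subset_closure hvK.2, hvK.1⟩
      rw [mul_comm, ← div_le_iff₀ hV] at hvm
      exact hvm.not_gt hv.2)
    ⟨w, ⟨trivial, hwm⟩, hw⟩ ⟨y, ⟨trivial, hym⟩, hy⟩
  exact hvK' (interior_subset hvK)

theorem one_sub_sq_mul_pow_le {q : ℝ} (hq : 0 ≤ q) (n : ℕ) :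
    (1 - (n * q) ^ 2) * (1 + q) ^ n ≤ 1 + n * q := by
  have hnq : 0 ≤ n * q := by positivity
  have key : (1 - n * q) * (1 + q) ^ n ≤ 1 := by
    rcases le_total 1 (n * q) with h | h
    · exact (mul_nonpos_of_nonpos_of_nonneg (by linarith) (by positivity)).trans zero_le_one
    · rcases Nat.eq_zero_or_pos n with rfl | hn
      · simp
      have hq1 : q ≤ 1 := by
        have : (1 : ℝ) ≤ n := by exact_mod_cast hn
        nlinarith
      have hb := one_add_mul_le_pow (a := -q) (by linarith) n
      calc (1 - n * q) * (1 + q) ^ n ≤ (1 + -q) ^ n * (1 + q) ^ n := by gcongr; linarith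
        _ = (1 - q ^ 2) ^ n := by rw [← mul_pow]; ring
        _ ≤ 1 := pow_le_one₀ (by nlinarith) (by nlinarith)
  calc (1 - (n * q) ^ 2) * (1 + q) ^ n = (1 + n * q) * ((1 - n * q) * (1 + q) ^ n) := by ring
    _ ≤ (1 + n * q) * 1 := by gcongr
    _ = _ := mul_one _

/-- Up to second order in the relative volume increase, the moment does not decrease. -/
theorem momentVolSimplex_mul_le (k : ℕ) {K L : Set (EuclideanSpace ℝ (Fin d))}
    (hK : IsConvexBody K) (hL : IsConvexBody L) (hKL : K ⊆ L)
    (hext : ∀ y ∉ K, totalMoment k K ≤ volume.real K * pointedMoment k K y) {q : ℝ}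
    (hq : volume.real L ≤ (1 + q) * volume.real K) :
    momentVolSimplex d k K * (1 - (((d + 1 : ℕ) : ℝ) * q) ^ 2) ≤ momentVolSimplex d k L := by
  have hV := hK.measureReal_pos
  have hle : volume.real K ≤ volume.real L := measureReal_mono hKL hL.1.measure_ne_top
  have hadd := add_le_totalMoment k hK.1.measurableSet hL.1 hKL
  set V := volume.real K with hVdef
  set W := volume.real L with hW
  set p := W / V - 1 with hp
  have hWp : W = (1 + p) * V := by rw [hp]; field_simp; ring
  have hp0 : 0 ≤ p := sub_nonneg.2 ((one_le_div hV).2 hle)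
  have hpq : p ≤ q := by rw [hp, sub_le_iff_le_add, div_le_iff₀ hV]; linarith
  set F := totalMoment k K with hF
  have hF0 : 0 ≤ F := totalMoment_nonneg k K
  have hint : p * F ≤ ∫ y in L \ K, pointedMoment k K y := by
    have : p * F = volume.real (L \ K) * (F / V) := by
      rw [measureReal_sdiff hKL hK.1.measurableSet hL.1.measure_ne_top, ← hW, ← hVdef, hWp]
      field_simp
      ring
    rw [this, ← smul_eq_mul, ← setIntegral_const]
    refine setIntegral_mono_on ?_ ?_ (hL.1.measurableSet.diff hK.1.measurableSet)
      fun y hy => ?_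
    · exact integrableOn_const (measure_ne_top_of_subset Set.sdiff_subset hL.1.measure_ne_top)
    · exact ((continuous_pointedMoment k hK.1).continuousOn.integrableOn_compact hL.1).mono_set
        Set.sdiff_subset
    · rw [div_le_iff₀ hV, mul_comm]
      exact hext y hy.2
  have hFL : F * (1 + ((d + 1 : ℕ) : ℝ) * p) ≤ totalMoment k L := by
    refine le_trans ?_ hadd
    push_cast
    calc F * (1 + (d + 1) * p) = F + (d + 1) * (p * F) := by ring
      _ ≤ _ := by gcongr
  rw [momentVolSimplex_eq, momentVolSimplex_eq, ← hVdef, ← hW, ← hF]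
  calc F / V ^ (d + 1) * (1 - (((d + 1 : ℕ) : ℝ) * q) ^ 2)
      ≤ F / V ^ (d + 1) * (1 - (((d + 1 : ℕ) : ℝ) * p) ^ 2) := by gcongr
    _ = F * ((1 - (((d + 1 : ℕ) : ℝ) * p) ^ 2) * (1 + p) ^ (d + 1)) / W ^ (d + 1) := by
        rw [hWp]; field_simp; ring
    _ ≤ F * (1 + ((d + 1 : ℕ) : ℝ) * p) / W ^ (d + 1) := by
        gcongr
        exact one_sub_sq_mul_pow_le hp0 _
    _ ≤ _ := by gcongr

/-- A nonnegative function that decreases at most to second order is monotone. -/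
theorem le_of_forall_mul_one_sub_sq_le {φ : ℝ → ℝ} {a b C : ℝ} (hab : a ≤ b)
    (h0 : 0 ≤ φ a)
    (h : ∀ t s, a ≤ t → t ≤ s → s ≤ b → φ t * (1 - C * (s - t) ^ 2) ≤ φ s) : φ a ≤ φ b := by
  have hC : Filter.Tendsto (fun n : ℕ => C * (b - a) ^ 2 / n) Filter.atTop (nhds 0) :=
    tendsto_const_div_atTop_nhds_zero_nat _
  have key : ∀ᶠ n : ℕ in Filter.atTop, φ a * (1 - C * (b - a) ^ 2 / n) ≤ φ b := by
    filter_upwards [hC.eventually_lt_const one_pos, Filter.eventually_ge_atTop 1] with n hn hn1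
    have hn0 : (1 : ℝ) ≤ n := by exact_mod_cast hn1
    set u : ℝ := C * (b - a) ^ 2 / n / n with hu
    have hu1 : u ≤ 1 := by
      rw [hu, div_le_one (by linarith)]
      linarith
    have hstep (i : ℕ) (hi : i ≤ n) : φ a * (1 - u) ^ i ≤ φ (a + i / n * (b - a)) := by
      induction i with
      | zero => simp
      | succ i ih =>
        have hi' : ((i : ℝ) + 1) / n ≤ 1 := by
          rw [div_le_one (by linarith)]
          exact_mod_cast hi
        have hba := sub_nonneg.2 hab
        have hs := h (a + i / n * (b - a)) (a + (i + 1 : ℕ) / n * (b - a))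
          (le_add_of_nonneg_right (by positivity)) (by push_cast; gcongr; linarith)
          (by push_cast; nlinarith)
        have hdiff : C * (a + (i + 1 : ℕ) / n * (b - a) - (a + i / n * (b - a))) ^ 2 = u := by
          rw [hu]; push_cast; field_simp; ring
        rw [hdiff] at hs
        calc φ a * (1 - u) ^ (i + 1) = φ a * (1 - u) ^ i * (1 - u) := by ring
          _ ≤ φ (a + i / n * (b - a)) * (1 - u) :=
            mul_le_mul_of_nonneg_right (ih (by omega)) (by linarith)
          _ ≤ _ := hs
    have hfin := hstep n le_rfl
    rw [div_self (by linarith), one_mul, add_sub_cancel] at hfin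
    refine le_trans (mul_le_mul_of_nonneg_left ?_ h0) hfin
    have := one_add_mul_le_pow (a := -u) (by linarith) n
    calc 1 - C * (b - a) ^ 2 / n = 1 + n * -u := by rw [hu]; field_simp; ring
      _ ≤ (1 + -u) ^ n := this
      _ = _ := by ring
  have hlim : Filter.Tendsto (fun n : ℕ => φ a * (1 - C * (b - a) ^ 2 / n)) Filter.atTop
      (nhds (φ a)) := by
    simpa using (hC.const_sub 1).const_mul (φ a)
  exact le_of_tendsto hlim key

theorem momentVolSimplex_le_of_exterior (k : ℕ)
    (hext : ∀ K : Set (EuclideanSpace ℝ (Fin d)), IsConvexBody K → ∀ y ∉ K,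
      totalMoment k K ≤ volume.real K * pointedMoment k K y)
    {K L : Set (EuclideanSpace ℝ (Fin d))} (hK : IsConvexBody K) (hL : IsConvexBody L)
    (hKL : K ⊆ L) : momentVolSimplex d k K ≤ momentVolSimplex d k L := by
  obtain ⟨c, hc⟩ := hK.2.2
  have hcK := interior_subset hc
  let S (t : ℝ) : Set (EuclideanSpace ℝ (Fin d)) := L ∩ AffineMap.homothety c t '' K
  have hmem {A : Set (EuclideanSpace ℝ (Fin d))} {t : ℝ} (ht : t ≠ 0) (z) :
      z ∈ AffineMap.homothety c t '' A ↔ AffineMap.homothety c t⁻¹ z ∈ A := by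
    constructor
    · rintro ⟨y, hy, rfl⟩
      rwa [← AffineMap.homothety_mul_apply, inv_mul_cancel₀ ht, AffineMap.homothety_one]
    · intro h
      refine ⟨_, h, ?_⟩
      rw [← AffineMap.homothety_mul_apply, mul_inv_cancel₀ ht, AffineMap.homothety_one,
        AffineMap.id_apply]
  have hScale {t s : ℝ} (ht : 1 ≤ t) (hts : t ≤ s) : s⁻¹ * t ∈ Set.Icc (0 : ℝ) 1 :=
    ⟨mul_nonneg (inv_nonneg.2 (by linarith)) (by linarith), by rw [inv_mul_le_iff₀ (by linarith)]; linarith⟩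
  have hSmono {t s : ℝ} (ht : 1 ≤ t) (hts : t ≤ s) : S t ⊆ S s := by
    rintro z ⟨hzL, y, hy, rfl⟩
    refine ⟨hzL, (hmem (by linarith) _).2 ?_⟩
    rw [← AffineMap.homothety_mul_apply]
    exact homothety_image_subset hK.2.1 hcK (hScale ht hts) ⟨y, hy, rfl⟩
  have hS1 : S 1 = K := by
    simp [S, Set.inter_eq_right.2 hKL]
  have hSbody {t : ℝ} (ht : 1 ≤ t) : IsConvexBody (S t) := by
    have hH := isConvexBody_homothety hK c (r := t) (by linarith)
    refine ⟨hL.1.inter hH.1, hL.2.1.inter hH.2.1, hK.2.2.mono (interior_mono ?_)⟩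
    simpa [hS1] using hSmono le_rfl ht
  have hSvol {t s : ℝ} (ht : 1 ≤ t) (hts : t ≤ s) :
      volume.real (S s) ≤ (s / t) ^ d * volume.real (S t) := by
    have hs0 : s ≠ 0 := by linarith
    have ht0 : t ≠ 0 := by linarith
    rw [← measureReal_homothety _ c (div_nonneg (by linarith) (by linarith))]
    refine measureReal_mono ?_
      ((hSbody ht).1.image (AffineMap.homothety_continuous c _)).measure_ne_top
    rintro z ⟨hzL, hz⟩
    rw [hmem hs0] at hz
    rw [hmem (by positivity), inv_div, div_eq_inv_mul]
    refine ⟨homothety_image_subset hL.2.1 (hKL hcK) (hScale ht hts) ⟨z, hzL, rfl⟩, ?_⟩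
    rw [hmem ht0, ← AffineMap.homothety_mul_apply]
    convert hz using 3
    field_simp
  obtain ⟨T, hT1, hST⟩ : ∃ T : ℝ, 1 ≤ T ∧ S T = L := by
    obtain ⟨ε, hε, hεK⟩ := Metric.isOpen_iff.1 isOpen_interior c hc
    obtain ⟨R, hR0, hR⟩ :=
      (hL.1.image (f := fun a => a - c) (by fun_prop)).isBounded.exists_pos_norm_le
    have hT0 : 0 < 1 + R / ε := by positivity
    refine ⟨1 + R / ε, le_add_of_nonneg_right (by positivity), Set.inter_eq_left.2 fun z hz => ?_⟩
    rw [hmem hT0.ne']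
    apply interior_subset
    apply hεK
    rw [Metric.mem_ball, AffineMap.homothety_apply, vsub_eq_sub, vadd_eq_add, dist_eq_norm,
      add_sub_cancel_right, norm_smul, norm_inv, Real.norm_of_nonneg hT0.le,
      inv_mul_lt_iff₀ hT0]
    calc ‖z - c‖ ≤ R := hR _ ⟨z, hz, rfl⟩
      _ < (1 + R / ε) * ε := by rw [add_mul, div_mul_cancel₀ _ hε.ne']; linarith
  have hφ := le_of_forall_mul_one_sub_sq_le (φ := fun t => momentVolSimplex d k (S t))
    (a := 1) (b := T) (C := (((d + 1 : ℕ) : ℝ) * (d * T ^ (d - 1))) ^ 2) hT1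
    (by
      simp only [momentVolSimplex_eq]
      exact div_nonneg (totalMoment_nonneg _ _) (by positivity))
    (fun t s ht hts hsT => by
      have hq : (s / t) ^ d ≤ 1 + (s - t) * d * T ^ (d - 1) := by
        have h1 : s / t - 1 ≤ s - t := by
          rw [div_sub_one (by linarith)]
          exact div_le_self (by linarith) ht
        have h2 : 1 ≤ s / t := (one_le_div (by linarith)).2 hts
        have h3 : s / t ≤ T := (div_le_self (by linarith) ht).trans hsT
        have h4 := abs_pow_sub_pow_le (s / t) 1 d
        rw [one_pow, abs_one, abs_of_nonneg (by linarith : 0 ≤ s / t), max_eq_left h2,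
          abs_of_nonneg (by linarith : 0 ≤ s / t - 1)] at h4
        have h5 : (s / t - 1) * d * (s / t) ^ (d - 1) ≤ (s - t) * d * T ^ (d - 1) := by
          gcongr
        linarith [le_abs_self ((s / t) ^ d - 1)]
      have hb := momentVolSimplex_mul_le k (hSbody ht) (hSbody (ht.trans hts)) (hSmono ht hts)
        (hext _ (hSbody ht)) (q := (s - t) * d * T ^ (d - 1))
        ((hSvol ht hts).trans (by gcongr))
      refine le_trans (le_of_eq ?_) hb
      ring)
  simpa [hS1, hST] using hφ

end SimplexMoment

/-- Monotonicity of `K ↦ E(V_K^k)` under inclusion holds in dimension `d` iff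
for every convex body `K ⊆ ℝ^d` and every boundary point `x` of `K`,
`E(V_K^k) ≤ E((vol conv{x, X₁, …, X_d})^k)`. -/
theorem momentVolSimplex_monotone_iff_boundary_point_bound
    (d k : ℕ) (hk : 1 ≤ k) :
    (∀ K L : Set (EuclideanSpace ℝ (Fin d)),
        IsConvexBody K → IsConvexBody L → K ⊆ L →
        momentVolSimplex d k K ≤ momentVolSimplex d k L) ↔
    (∀ K : Set (EuclideanSpace ℝ (Fin d)), IsConvexBody K →
        ∀ x ∈ frontier K,
          momentVolSimplex d k K ≤
            ⨍ X : Fin d → EuclideanSpace ℝ (Fin d) in Set.univ.pi (fun _ => K),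
              (volume (convexHull ℝ (insert x (Set.range X)))).toReal ^ k) := by
  have hiff {K : Set (EuclideanSpace ℝ (Fin d))} (hK : IsConvexBody K)
      (x : EuclideanSpace ℝ (Fin d)) :
      momentVolSimplex d k K ≤
          ⨍ X : Fin d → EuclideanSpace ℝ (Fin d) in Set.univ.pi (fun _ => K),
            (volume (convexHull ℝ (insert x (Set.range X)))).toReal ^ k ↔
        SimplexMoment.totalMoment k K ≤
          volume.real K * SimplexMoment.pointedMoment k K x := by
    have hV := hK.measureReal_pos
    rw [SimplexMoment.setAverage_insert_eq, SimplexMoment.momentVolSimplex_eq,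
      div_le_div_iff₀ (by positivity) (by positivity), pow_succ', ← mul_assoc,
      mul_comm _ (volume.real K), mul_le_mul_iff_left₀ (by positivity)]
  rcases d with _ | d
  · have huniv {K : Set (EuclideanSpace ℝ (Fin 0))} (hK : IsConvexBody K) : K = Set.univ :=
      (hK.2.2.mono interior_subset).eq_univ
    constructor
    · intro _ K hK x hx
      simp [huniv hK] at hx
    · intro _ K L hK hL _
      rw [huniv hK, huniv hL]
  · constructor
    · intro h K hK x hx
      rw [hiff hK]
      exact SimplexMoment.totalMoment_le_of_mono k h hK hx (measure_singleton x)
    · intro h K L hK hL hKL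
      refine SimplexMoment.momentVolSimplex_le_of_exterior k (fun K hK y hy => ?_) hK hL hKL
      exact SimplexMoment.totalMoment_le_of_notMem k hK (fun x hx => (hiff hK x).1 (h K hK x hx)) hy
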